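/- arXiv:2510.03600 — 2 statements merged into one kernel-verified Lean document; each statement's English description precedes it below -/
import Mathlib

section
/- Let 0 < α ≤ 1/2. Then E_{α,1}(i t) ≠ 0 for all t ∈ ℝ. -/
open Complex Real

/-- The Mittag-Leffler function `E_{α,β}(z) = ∑ zⁿ / Γ(αn+β)`. -/
noncomputable def mlE (α β : ℝ) (z : ℂ) : ℂ :=
  ∑' n : ℕ, z ^ n / Complex.Gamma ((α * n + β : ℝ) : ℂ)

open MeasureTheory
lemma gamma_lower (M s : ℝ) (hM : 0 < M) (hs : 0 ≤ s) :
    M ^ s * Real.exp (-M) ≤ Real.Gamma (s + 1) := by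
  rw [Real.Gamma_eq_integral (by linarith)]
  have h1 : IntegrableOn (fun x : ℝ => Real.exp (-x) * x ^ (s + 1 - 1)) (Set.Ioi 0) :=
    Real.GammaIntegral_convergent (by linarith)
  have h2 : M ^ s * Real.exp (-M) = ∫ x in Set.Ioi M, M ^ s * Real.exp (-x) := by
    rw [integral_const_mul, integral_exp_neg_Ioi]
  rw [h2]
  calc _ ≤ ∫ x in Set.Ioi M, Real.exp (-x) * x ^ (s + 1 - 1) := by
        apply setIntegral_mono_on
        · exact (integrableOn_exp_neg_Ioi M).const_mul _
        · exact h1.mono_set (Set.Ioi_subset_Ioi hM.le)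
        · exact measurableSet_Ioi
        · intro x hx
          rw [mul_comm, add_sub_cancel_right]
          have : M ≤ x := le_of_lt hx
          gcongr
    _ ≤ _ := by
        apply setIntegral_mono_set h1
        · filter_upwards [ae_restrict_mem measurableSet_Ioi] with x hx
          have : (0:ℝ) < x := hx
          simp only [Pi.zero_apply]; positivity
        · exact (Set.Ioi_subset_Ioi hM.le).eventuallyLE

lemma ml_summable (γ β x : ℝ) (hγ : 0 < γ) (hβ : 1 ≤ β) (hx : 0 ≤ x) :
    Summable (fun n : ℕ => x ^ n / Real.Gamma (γ * n + β)) := by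
  set M : ℝ := (2 * x + 1) ^ (γ⁻¹) with hMd
  have hM1 : 1 ≤ M := Real.one_le_rpow (by linarith) (by positivity)
  have hM : 0 < M := by linarith
  have hMγ : M ^ γ = 2 * x + 1 := by
    rw [hMd, ← Real.rpow_mul (by linarith), inv_mul_cancel₀ hγ.ne', Real.rpow_one]
  have hgeo : Summable (fun n : ℕ => Real.exp M * (x / (2 * x + 1)) ^ n) := by
    apply Summable.mul_left
    apply summable_geometric_of_lt_one (by positivity)
    rw [div_lt_one (by linarith)]; linarith
  refine Summable.of_nonneg_of_le (fun n => ?_) (fun n => ?_) hgeo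
  · have : 0 < Real.Gamma (γ * n + β) := Real.Gamma_pos_of_pos (by positivity)
    positivity
  · have h := gamma_lower M (γ * n + β - 1) hM (by have : 0 ≤ γ * n := by positivity
                                                   linarith)
    rw [sub_add_cancel] at h
    have h2 : (2 * x + 1) ^ n ≤ M ^ (γ * n + β - 1) := by
      rw [← hMγ, ← Real.rpow_natCast, ← Real.rpow_mul hM.le]
      exact Real.rpow_le_rpow_of_exponent_le hM1 (by linarith)
    have h3 : (2 * x + 1) ^ n * Real.exp (-M) ≤ Real.Gamma (γ * n + β) :=
      le_trans (by gcongr) h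
    calc _ ≤ x ^ n / ((2 * x + 1) ^ n * Real.exp (-M)) := by gcongr
      _ = _ := by rw [Real.exp_neg, div_pow]; field_simp

noncomputable def mlg (γ x : ℝ) : ℝ := ∑' n : ℕ, (-x) ^ n / Real.Gamma (γ * n + 1)

lemma mlg_summable (γ x : ℝ) (hγ : 0 < γ) :
    Summable (fun n : ℕ => (-x) ^ n / Real.Gamma (γ * n + 1)) := by
  refine Summable.of_norm ?_
  convert ml_summable γ 1 |x| hγ le_rfl (abs_nonneg x) using 2 with n
  have : 0 < Real.Gamma (γ * n + 1) := Real.Gamma_pos_of_pos (by positivity)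
  rw [norm_div, norm_pow, Real.norm_eq_abs, Real.norm_eq_abs, abs_neg, abs_of_pos this]

lemma mlg_lip (γ R : ℝ) (hγ : 0 < γ) (hR : 1 ≤ R) : ∃ C, 0 ≤ C ∧ ∀ x y, |x| ≤ R → |y| ≤ R →
    |mlg γ x - mlg γ y| ≤ C * |x - y| := by
  have hs := ml_summable γ 1 (2 * R) hγ le_rfl (by linarith)
  have hG : ∀ n : ℕ, 0 < Real.Gamma (γ * n + 1) := fun n =>
    Real.Gamma_pos_of_pos (by positivity)
  refine ⟨∑' n : ℕ, (2 * R) ^ n / Real.Gamma (γ * n + 1), 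
    tsum_nonneg fun n => by have := hG n; positivity, fun x y hx hy => ?_⟩
  rw [mlg, mlg, ← (mlg_summable γ x hγ).tsum_sub (mlg_summable γ y hγ), ← tsum_mul_right]
  rw [← Real.norm_eq_abs]
  refine tsum_of_norm_bounded (hs.mul_right _).hasSum fun n => ?_
  have hGn := hG n
  rw [← sub_div, norm_div, Real.norm_eq_abs, Real.norm_eq_abs, abs_of_pos hGn, div_mul_eq_mul_div]
  gcongr
  refine (abs_pow_sub_pow_le _ _ _).trans ?_
  rw [abs_neg, abs_neg, mul_pow, neg_sub_neg, abs_sub_comm y x, mul_assoc, mul_comm]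
  have h1 : (n : ℝ) ≤ 2 ^ n := by exact_mod_cast Nat.lt_two_pow_self.le
  have h2 : max |x| |y| ^ (n - 1) ≤ R ^ n :=
    (pow_le_pow_left₀ (by positivity) (max_le hx hy) _).trans
      (pow_le_pow_right₀ hR (Nat.sub_le _ _))
  gcongr

lemma mlg_continuous (γ : ℝ) (hγ : 0 < γ) : Continuous (mlg γ) := by
  rw [continuous_iff_continuousAt]
  intro a
  obtain ⟨C, hC, h⟩ := mlg_lip γ (|a| + 1) hγ (by linarith [abs_nonneg a])
  rw [ContinuousAt, tendsto_iff_norm_sub_tendsto_zero]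
  have h0 : Filter.Tendsto (fun x => C * |x - a|) (nhds a) (nhds 0) := by
    have : Continuous (fun x => C * |x - a|) := by fun_prop
    simpa using this.tendsto a
  refine squeeze_zero' (Filter.Eventually.of_forall fun _ => norm_nonneg _) ?_ h0
  filter_upwards [Metric.ball_mem_nhds a one_pos] with x hx
  rw [Metric.mem_ball, Real.dist_eq] at hx
  refine h x a ?_ (by linarith)
  have := abs_sub_abs_le_abs_sub x a
  linarith

lemma beta_real (p b t : ℝ) (hp : 0 ≤ p) (hb : 0 < b) (ht : 0 < t) :
    ∫ s in (0:ℝ)..t, s ^ p * (t - s) ^ (b - 1)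
      = t ^ (p + b) * (Real.Gamma (p + 1) * Real.Gamma b / Real.Gamma (p + 1 + b)) := by
  have h := Complex.betaIntegral_scaled ((p + 1 : ℝ) : ℂ) (b : ℂ) ht
  rw [Complex.betaIntegral_eq_Gamma_mul_div _ _ (by simp; linarith) (by simpa)] at h
  have h2 : ∫ s in (0:ℝ)..t, (s : ℂ) ^ (((p + 1 : ℝ) : ℂ) - 1) * ((t : ℂ) - s) ^ ((b : ℂ) - 1)
      = ((∫ s in (0:ℝ)..t, s ^ p * (t - s) ^ (b - 1) : ℝ) : ℂ) := by
    rw [← intervalIntegral.integral_ofReal]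
    refine intervalIntegral.integral_congr fun s hs => ?_
    rw [Set.uIcc_of_le ht.le] at hs
    show _ = ((s ^ p * (t - s) ^ (b - 1) : ℝ) : ℂ)
    rw [Complex.ofReal_mul, Complex.ofReal_cpow hs.1, Complex.ofReal_cpow (by linarith [hs.2])]
    push_cast
    ring_nf
  rw [h2] at h
  apply Complex.ofReal_injective
  rw [h, Complex.ofReal_mul, Complex.ofReal_cpow ht.le, Complex.ofReal_div, Complex.ofReal_mul,
    ← Complex.Gamma_ofReal, ← Complex.Gamma_ofReal, ← Complex.Gamma_ofReal]
  push_cast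
  ring_nf

lemma kern_int (b t a c : ℝ) (hb : 0 < b) (f : ℝ → ℝ) (hf : Continuous f) :
    IntervalIntegrable (fun s => f s * (t - s) ^ (b - 1)) volume a c := by
  apply IntervalIntegrable.continuousOn_mul _ hf.continuousOn
  have := (intervalIntegral.intervalIntegrable_rpow' (a := t - a) (b := t - c)
    (r := b - 1) (by linarith)).comp_sub_left t
  simpa using this

lemma conv_sum (γ b t : ℝ) (hγ : 0 < γ) (hb : 0 < b) (ht : 0 < t) :
    HasSum (fun n : ℕ => (-1) ^ n * (Real.Gamma b * t ^ (γ * n + b) / Real.Gamma (γ * n + 1 + b)))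
      (∫ s in (0:ℝ)..t, mlg γ (s ^ γ) * (t - s) ^ (b - 1)) := by
  have hG : ∀ n : ℕ, 0 < Real.Gamma (γ * n + 1) := fun n =>
    Real.Gamma_pos_of_pos (by positivity)
  let F : ℕ → ℝ → ℝ := fun n s =>
    ((-1) ^ n / Real.Gamma (γ * n + 1)) * (s ^ (γ * n) * (t - s) ^ (b - 1))
  have hint : ∀ n, IntegrableOn (F n) (Set.Ioc 0 t) := fun n => by
    have := kern_int b t 0 t hb (fun s => s ^ (γ * n))
      (Real.continuous_rpow_const (by positivity))
    exact ((intervalIntegrable_iff_integrableOn_Ioc_of_le ht.le).1 this).const_mul _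
  have hval : ∀ n : ℕ, ∫ s in Set.Ioc 0 t, s ^ (γ * n) * (t - s) ^ (b - 1)
     = t ^ (γ * n + b) * (Real.Gamma (γ * n + 1) * Real.Gamma b / Real.Gamma (γ * n + 1 + b)) := by
    intro n
    rw [← beta_real (γ * n) b t (by positivity) hb ht, intervalIntegral.integral_of_le ht.le]
  have hnorm : ∀ n : ℕ, ∫ s in Set.Ioc 0 t, ‖F n s‖ = 
      Real.Gamma b * t ^ (γ * n + b) / Real.Gamma (γ * n + 1 + b) := by
    intro n
    have hGn := hG n
    have : ∫ s in Set.Ioc 0 t, ‖F n s‖ = ∫ s in Set.Ioc 0 t, 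
        (1 / Real.Gamma (γ * n + 1)) * (s ^ (γ * n) * (t - s) ^ (b - 1)) := by
      refine setIntegral_congr_fun measurableSet_Ioc fun s hs => ?_
      have h1 : 0 ≤ s ^ (γ * n) := Real.rpow_nonneg hs.1.le _
      have h2 : 0 ≤ (t - s) ^ (b - 1) := Real.rpow_nonneg (by linarith [hs.2]) _
      simp only [F, norm_mul, norm_div, norm_pow, norm_neg, norm_one, one_pow, Real.norm_eq_abs,
        abs_of_pos hGn, abs_of_nonneg h1, abs_of_nonneg h2]
    rw [this, integral_const_mul, hval]
    field_simp
  have hsum : Summable fun n : ℕ => ∫ s in Set.Ioc 0 t, ‖F n s‖ := by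
    simp_rw [hnorm]
    refine ((ml_summable γ (1 + b) (t ^ γ) hγ (by linarith) (by positivity)).mul_left
      (Real.Gamma b * t ^ b)).congr fun n => ?_
    rw [Real.rpow_add ht, Real.rpow_mul ht.le, Real.rpow_natCast, ← add_assoc]
    ring
  have key := hasSum_integral_of_summable_integral_norm (μ := volume.restrict (Set.Ioc 0 t))
    hint hsum
  rw [intervalIntegral.integral_of_le ht.le]
  have e1 : (fun n : ℕ => (-1) ^ n * (Real.Gamma b * t ^ (γ * n + b) / Real.Gamma (γ * n + 1 + b)))
      = fun n => ∫ s in Set.Ioc 0 t, F n s := by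
    ext n
    have hGn := hG n
    simp only [F]
    rw [integral_const_mul, hval]
    field_simp
  have e2 : ∫ s in Set.Ioc 0 t, mlg γ (s ^ γ) * (t - s) ^ (b - 1)
      = ∫ s in Set.Ioc 0 t, ∑' n, F n s := by
    refine setIntegral_congr_fun measurableSet_Ioc fun s hs => ?_
    simp only [F, mlg]
    rw [← tsum_mul_right]
    congr 1
    ext n
    rw [Real.rpow_mul hs.1.le, Real.rpow_natCast, neg_pow]
    ring
  rw [e1, e2]
  exact key

lemma conv_id (γ t : ℝ) (hγ : 0 < γ) (hγ1 : γ < 1) (ht : 0 < t) :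
    ∫ s in (0:ℝ)..t, mlg γ (s ^ γ) * (t - s) ^ (-γ) = t ^ (1 - γ) / (1 - γ)
      - Real.Gamma (1 - γ) * ∫ s in (0:ℝ)..t, mlg γ (s ^ γ) := by
  have h1 := conv_sum γ (1 - γ) t hγ (by linarith) ht
  have h2 := (conv_sum γ 1 t hγ one_pos ht).mul_left (-Real.Gamma (1 - γ))
  have h3 := (hasSum_nat_add_iff' 1).2 h1
  have e : (fun s => mlg γ (s ^ γ) * (t - s) ^ (1 - γ - 1)) =
    fun s => mlg γ (s ^ γ) * (t - s) ^ (-γ) := by ext s; congr 2; ring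
  simp only [sub_self, Real.rpow_zero, mul_one] at h2
  rw [e] at h3
  have h5 : (fun n : ℕ => (-1 : ℝ) ^ (n + 1) * (Real.Gamma (1 - γ) * t ^ (γ * ((n + 1 : ℕ) : ℝ)
      + (1 - γ)) / Real.Gamma (γ * ((n + 1 : ℕ) : ℝ) + 1 + (1 - γ)))) = fun n : ℕ =>
      -Real.Gamma (1 - γ) * ((-1) ^ n * (Real.Gamma 1 * t ^ (γ * n + 1) /
        Real.Gamma (γ * n + 1 + 1))) := by
    ext n
    push_cast
    rw [pow_succ, show γ * ((n:ℝ) + 1) + (1 - γ) = γ * n + 1 by ring,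
      show γ * ((n:ℝ) + 1) + 1 + (1 - γ) = γ * n + 1 + 1 by ring, Real.Gamma_one]
    ring
  rw [h5] at h3
  have h4 := h3.unique h2
  have hg : Real.Gamma (1 + (1 - γ)) = (1 - γ) * Real.Gamma (1 - γ) := by
    rw [add_comm, Real.Gamma_add_one (by linarith)]
  have hp : 0 < Real.Gamma (1 - γ) := Real.Gamma_pos_of_pos (by linarith)
  have h1γ : (1 - γ) ≠ 0 := by linarith
  simp only [Finset.range_one, Finset.sum_singleton, pow_zero, Nat.cast_zero, mul_zero, zero_add,
    one_mul, hg] at h4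
  rw [sub_eq_iff_eq_add] at h4
  rw [h4]
  field_simp
  ring

lemma mlg_zero (γ : ℝ) : mlg γ 0 = 1 := by
  rw [mlg, tsum_eq_single 0]
  · simp
  · intro n hn
    simp [hn]

lemma mlg_pos_lt (γ : ℝ) (hγ : 0 < γ) (hγ1 : γ < 1) (T : ℝ) (hT : 0 ≤ T) :
    0 < mlg γ (T ^ γ) := by
  by_contra hneg
  push Not at hneg
  let u : ℝ → ℝ := fun t => mlg γ (t ^ γ)
  have hu : Continuous u := (mlg_continuous γ hγ).comp (Real.continuous_rpow_const hγ.le)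
  have hu0 : u 0 = 1 := by simp only [u]; rw [Real.zero_rpow hγ.ne', mlg_zero]
  have hcomp : IsCompact (Set.Icc 0 T ∩ {s | u s ≤ 0}) :=
    isCompact_Icc.inter_right (isClosed_le hu continuous_const)
  obtain ⟨r, ⟨⟨hrI, hru⟩, hrmin⟩⟩ := hcomp.exists_isLeast ⟨T, ⟨hT, le_rfl⟩, hneg⟩
  have hru : u r ≤ 0 := hru
  have hr : 0 < r := by
    rcases hrI.1.eq_or_lt with h | h
    · rw [← h, hu0] at hru; linarith
    · exact h
  have hpos : ∀ s, 0 ≤ s → s < r → 0 < u s := by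
    intro s hs hsr
    by_contra hc
    push Not at hc
    have := hrmin ⟨⟨hs, hsr.le.trans hrI.2⟩, hc⟩
    linarith
  -- Lipschitz bound
  obtain ⟨C, hC, hlip⟩ : ∃ C, 0 ≤ C ∧ ∀ s, 0 ≤ s → s ≤ r → u s ≤ C * (r - s) := by
    obtain ⟨C, hC, h⟩ := mlg_lip γ (r ^ γ + 1) hγ (by have : 0 ≤ r ^ γ := by positivity
                                                      linarith)
    have hrp : 0 < r ^ γ := by positivity
    refine ⟨C * (r ^ γ / r), by positivity, fun s hs hsr => ?_⟩
    have hsp : 0 ≤ s ^ γ := by positivity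
    have hsr' : s ^ γ ≤ r ^ γ := by gcongr
    have h1 := h (s ^ γ) (r ^ γ) (by rw [abs_of_nonneg hsp]; linarith)
      (by rw [abs_of_pos hrp]; linarith)
    have h2 : s / r ≤ (s / r) ^ γ := by
      apply Real.self_le_rpow_of_le_one (by positivity) _ hγ1.le
      rw [div_le_one hr]; exact hsr
    rw [Real.div_rpow hs hr.le, le_div_iff₀ hrp] at h2
    rw [abs_sub_comm (s ^ γ), abs_of_nonneg (sub_nonneg.2 hsr')] at h1
    have h3 : r ^ γ - s ^ γ ≤ r ^ γ / r * (r - s) := by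
      have : r ^ γ / r * (r - s) = r ^ γ - s / r * r ^ γ := by field_simp
      rw [this]; linarith
    have h4 := (le_abs_self _).trans h1
    have h5 := mul_le_mul_of_nonneg_left h3 hC
    simp only [u] at hru ⊢
    rw [mul_assoc]
    linarith
  have hΓ : 0 < Real.Gamma (1 - γ) := Real.Gamma_pos_of_pos (by linarith)
  have hki : ∀ t a c : ℝ, IntervalIntegrable (fun s => u s * (t - s) ^ (-γ)) volume a c := by
    intro t a c
    have := kern_int (1 - γ) t a c (by linarith) u hu
    rwa [show 1 - γ - 1 = -γ by ring] at this
  have main : ∀ h, 0 < h → h < r →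
      r ^ (-γ) ≤ C * h ^ (1 - γ) + Real.Gamma (1 - γ) * (C * h) := by
    intro h hh hhr
    have ht : 0 < r - h := by linarith
    have i1 := conv_id γ r hγ hγ1 hr
    have i2 := conv_id γ (r - h) hγ hγ1 ht
    change ∫ s in (0:ℝ)..r, u s * (r - s) ^ (-γ) = r ^ (1 - γ) / (1 - γ)
      - Real.Gamma (1 - γ) * ∫ s in (0:ℝ)..r, u s at i1
    change ∫ s in (0:ℝ)..(r - h), u s * (r - h - s) ^ (-γ) = (r - h) ^ (1 - γ) / (1 - γ)
      - Real.Gamma (1 - γ) * ∫ s in (0:ℝ)..(r - h), u s at i2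
    rw [← intervalIntegral.integral_add_adjacent_intervals (hki r 0 (r - h)) (hki r (r - h) r),
      ← intervalIntegral.integral_add_adjacent_intervals (hu.intervalIntegrable 0 (r - h))
        (hu.intervalIntegrable (r - h) r)] at i1
    have j1 : ∫ s in (0:ℝ)..(r - h), u s * (r - s) ^ (-γ) ≤
        ∫ s in (0:ℝ)..(r - h), u s * (r - h - s) ^ (-γ) := by
      apply intervalIntegral.integral_mono_on_of_le_Ioo ht.le (hki _ _ _) (hki _ _ _)
      intro s hs
      have := hpos s hs.1.le (by linarith [hs.2])
      apply mul_le_mul_of_nonneg_left _ this.le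
      exact Real.rpow_le_rpow_of_nonpos (by linarith [hs.2]) (by linarith) (by linarith)
    have j2 : ∫ s in (r - h)..r, u s * (r - s) ^ (-γ) ≤ h * (C * h ^ (1 - γ)) := by
      have : ∫ s in (r - h)..r, u s * (r - s) ^ (-γ) ≤ ∫ s in (r - h)..r, C * h ^ (1 - γ) := by
        apply intervalIntegral.integral_mono_on_of_le_Ioo (by linarith) (hki _ _ _) (by simp)
        intro s hs
        have hrs : 0 < r - s := by linarith [hs.2]
        have h1 := hlip s (by linarith [hs.1]) hs.2.le
        calc u s * (r - s) ^ (-γ) ≤ C * (r - s) * (r - s) ^ (-γ) := by gcongr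
          _ = C * (r - s) ^ (1 - γ) := by
            rw [sub_eq_add_neg 1 γ, Real.rpow_add hrs, Real.rpow_one]; ring
          _ ≤ C * h ^ (1 - γ) := by
            gcongr
            linarith [hs.1]
      rw [intervalIntegral.integral_const, smul_eq_mul, sub_sub_cancel] at this
      exact this
    have j3 : ∫ s in (r - h)..r, u s ≤ h * (C * h) := by
      have : ∫ s in (r - h)..r, u s ≤ ∫ s in (r - h)..r, C * h := by
        apply intervalIntegral.integral_mono_on_of_le_Ioo (by linarith)
          (hu.intervalIntegrable _ _) (by simp)
        intro s hs
        have h1 := hlip s (by linarith [hs.1]) hs.2.le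
        refine h1.trans ?_
        gcongr
        linarith [hs.1]
      rw [intervalIntegral.integral_const, smul_eq_mul, sub_sub_cancel] at this
      exact this
    have j4 : h * r ^ (-γ) ≤ r ^ (1 - γ) / (1 - γ) - (r - h) ^ (1 - γ) / (1 - γ) := by
      have b := rpow_one_add_le_one_add_mul_self (s := -(h / r))
        (by rw [neg_le_neg_iff, div_le_one hr]; exact hhr.le) (p := 1 - γ) (by linarith)
        (by linarith)
      have e : 1 + -(h / r) = (r - h) / r := by field_simp; ring
      have hrp : 0 < r ^ (1 - γ) := by positivity
      rw [e, Real.div_rpow ht.le hr.le, div_le_iff₀ hrp] at b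
      have e2 : r ^ (1 - γ) = r * r ^ (-γ) := by
        rw [sub_eq_add_neg 1 γ, Real.rpow_add hr, Real.rpow_one]
      have h1γ : 0 < 1 - γ := by linarith
      rw [← sub_div, le_div_iff₀ h1γ]
      have e3 : (1 + (1 - γ) * -(h / r)) * r ^ (1 - γ) =
          r ^ (1 - γ) - h * r ^ (-γ) * (1 - γ) := by
        rw [e2]; field_simp; ring
      rw [e3] at b
      linarith
    have j5 := mul_le_mul_of_nonneg_left j3 hΓ.le
    have : h * r ^ (-γ) ≤ h * (C * h ^ (1 - γ) + Real.Gamma (1 - γ) * (C * h)) := by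
      nlinarith
    exact le_of_mul_le_mul_left this hh
  have hlim : Filter.Tendsto (fun h : ℝ => C * h ^ (1 - γ) + Real.Gamma (1 - γ) * (C * h))
      (nhdsWithin 0 (Set.Ioi 0)) (nhds 0) := by
    have hc : Continuous (fun h : ℝ => C * h ^ (1 - γ) + Real.Gamma (1 - γ) * (C * h)) := by
      have := Real.continuous_rpow_const (q := 1 - γ) (by linarith)
      fun_prop
    have := hc.tendsto 0
    rw [Real.zero_rpow (by linarith)] at this
    simp only [mul_zero, add_zero] at this
    exact this.mono_left nhdsWithin_le_nhds
  have hle : r ^ (-γ) ≤ 0 := by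
    apply ge_of_tendsto hlim
    filter_upwards [Ioo_mem_nhdsGT hr] with h hh
    exact main h hh.1 hh.2
  have : 0 < r ^ (-γ) := by positivity
  linarith

lemma mlg_pos (γ : ℝ) (hγ : 0 < γ) (hγ1 : γ ≤ 1) (x : ℝ) (hx : 0 ≤ x) : 0 < mlg γ x := by
  rcases hγ1.eq_or_lt with rfl | h
  · have : mlg 1 x = Real.exp (-x) := by
      rw [mlg, Real.exp_eq_exp_ℝ, NormedSpace.exp_eq_tsum_div]
      congr 1
      ext n
      rw [one_mul, Real.Gamma_nat_eq_factorial]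
    rw [this]; positivity
  · have := mlg_pos_lt γ hγ h (x ^ γ⁻¹) (by positivity)
    rwa [← Real.rpow_mul hx, inv_mul_cancel₀ hγ.ne', Real.rpow_one] at this

theorem mittagLeffler_no_imaginary_zeros_small (α : ℝ) (hα0 : 0 < α) (hα : α ≤ 1 / 2) :
    ∀ t : ℝ, mlE α 1 (Complex.I * t) ≠ 0 := by
  intro t h0
  have hs : Summable (fun n : ℕ => (Complex.I * t) ^ n / Complex.Gamma ((α * n + 1 : ℝ) : ℂ)) := by
    refine Summable.of_norm ?_
    convert ml_summable α 1 |t| hα0 le_rfl (abs_nonneg t) using 2 with n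
    have : 0 < Real.Gamma (α * n + 1) := Real.Gamma_pos_of_pos (by positivity)
    rw [Complex.Gamma_ofReal, norm_div, norm_pow, Complex.norm_real, norm_mul, Complex.norm_I,
      Complex.norm_real, one_mul, Real.norm_eq_abs, Real.norm_eq_abs, abs_of_pos this]
  have h1 := Complex.hasSum_re hs.hasSum
  change HasSum _ (mlE α 1 (Complex.I * t)).re at h1
  rw [h0, Complex.zero_re] at h1
  have hinj : Function.Injective (fun k : ℕ => 2 * k) := fun a b h => by
    simpa using h
  rw [← hinj.hasSum_iff] at h1
  · have h2 := (mlg_summable (2 * α) (t ^ 2) (by linarith)).hasSum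
    have hp := mlg_pos (2 * α) (by linarith) (by linarith) (t ^ 2) (by positivity)
    have e : mlg (2 * α) (t ^ 2) = 0 := by
      refine h2.unique ?_
      convert h1 using 2 with k
      simp only [Function.comp]
      rw [Complex.Gamma_ofReal, pow_mul, mul_pow, Complex.I_sq]
      rw [show (-1 * (t : ℂ) ^ 2) ^ k / ((Real.Gamma (α * ((2 * k : ℕ) : ℝ) + 1) : ℝ) : ℂ) =
        (((-t ^ 2) ^ k / Real.Gamma (α * ((2 * k : ℕ) : ℝ) + 1) : ℝ) : ℂ) by push_cast; ring,
        Complex.ofReal_re]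
      push_cast
      ring_nf
    linarith
  · intro n hn
    have hodd : Odd n := by
      rw [← Nat.not_even_iff_odd]
      rintro ⟨k, hk⟩
      exact hn ⟨k, by simp only []; omega⟩
    obtain ⟨k, rfl⟩ := hodd
    rw [Complex.Gamma_ofReal, Complex.div_ofReal_re, pow_succ, pow_mul, mul_pow, Complex.I_sq,
      show (-1 * (t : ℂ) ^ 2) ^ k * (Complex.I * t) =
        (((-t ^ 2) ^ k * t : ℝ) : ℂ) * Complex.I by push_cast; ring,
      Complex.re_ofReal_mul, Complex.I_re, mul_zero, zero_div]
end

section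
/- Let 0 < α < 1 and T > 0. There exists a constant C > 0 such that |E_{α,1}(-i λ T^α)|^{-1} ≤ C λ for all λ ≥ λ₁ > 0, provided E_{α,1}(-i λ T^α) ≠ 0 for all such λ. -/
open Complex Real

open MeasureTheory Filter Topology Set FourierTransform

lemma ml_int_aux (s : ℝ) (hs : 0 < s) (b : ℝ) (hb : 0 < b) :
    IntegrableOn (fun t : ℝ => t ^ (s - 1) * Real.exp (-(b * t))) (Ioi 0) := by
  have := integrableOn_rpow_mul_exp_neg_mul_rpow (p := 1) (s := s - 1) (b := b) (by linarith) (by norm_num) hb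
  refine this.congr_fun (fun t _ => ?_) measurableSet_Ioi
  simp

lemma ml_norm_aux (s : ℝ) (r : ℂ) {t : ℝ} (ht : 0 < t) :
    ‖((t ^ (s - 1) : ℝ) : ℂ) * Complex.exp (-(r * t))‖ = t ^ (s - 1) * Real.exp (-(r.re * t)) := by
  rw [norm_mul, Complex.norm_exp, Complex.norm_real, Real.norm_of_nonneg (by positivity)]
  simp

lemma ml_meas_aux (s : ℝ) (r : ℂ) :
    AEStronglyMeasurable (fun t : ℝ => ((t ^ (s - 1) : ℝ) : ℂ) * Complex.exp (-(r * t)))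
      (volume.restrict (Ioi 0)) := by
  apply Measurable.aestronglyMeasurable
  fun_prop

lemma ml_int_aux2 (s : ℝ) (hs : 0 < s) (r : ℂ) (hr : 0 < r.re) :
    IntegrableOn (fun t : ℝ => ((t ^ (s - 1) : ℝ) : ℂ) * Complex.exp (-(r * t))) (Ioi 0) := by
  refine (ml_int_aux s hs r.re hr).mono' (ml_meas_aux s r) ?_
  filter_upwards [ae_restrict_mem measurableSet_Ioi] with t ht
  rw [ml_norm_aux s r ht]

lemma ml_laplace_diff (s : ℝ) (hs : 0 < s) (r : ℂ) (hr : 0 < r.re) :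
    DifferentiableAt ℂ (fun r : ℂ => ∫ t in Ioi (0:ℝ), ((t ^ (s - 1) : ℝ) : ℂ) * Complex.exp (-(r * t))) r := by
  have hU : {z : ℂ | r.re / 2 < z.re} ∈ 𝓝 r :=
    (isOpen_lt continuous_const Complex.continuous_re).mem_nhds (by simp; linarith)
  have key := hasDerivAt_integral_of_dominated_loc_of_deriv_le (𝕜 := ℂ)
    (μ := volume.restrict (Ioi (0:ℝ))) (x₀ := r) (s := {z : ℂ | r.re / 2 < z.re})
    (F := fun r (t:ℝ) => ((t ^ (s - 1) : ℝ) : ℂ) * Complex.exp (-(r * t)))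
    (F' := fun r (t:ℝ) => ((t ^ (s - 1) : ℝ) : ℂ) * (Complex.exp (-(r * t)) * (-t)))
    (bound := fun t => t ^ ((s + 1) - 1) * Real.exp (-((r.re / 2) * t)))
    hU (Eventually.of_forall fun z => ml_meas_aux s z) (ml_int_aux2 s hs r hr) ?_ ?_
    (ml_int_aux (s + 1) (by linarith) (r.re / 2) (by linarith)) ?_
  · exact key.2.differentiableAt
  · apply Measurable.aestronglyMeasurable
    fun_prop
  · filter_upwards [ae_restrict_mem measurableSet_Ioi] with t ht z hz
    have ht' : 0 < t := ht
    rw [← mul_assoc, norm_mul, ml_norm_aux s z ht, norm_neg, Complex.norm_real,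
      Real.norm_of_nonneg ht'.le, add_sub_right_comm, Real.rpow_add_one ht'.ne',
      mul_right_comm]
    have hz' : r.re / 2 ≤ z.re := le_of_lt hz
    gcongr
  · filter_upwards with t z hz
    have : HasDerivAt (fun z : ℂ => -(z * t)) (-(t:ℂ)) z := by
      simpa using ((hasDerivAt_id' z).mul_const (t:ℂ)).fun_neg
    exact this.cexp.const_mul _

lemma ml_laplace (s : ℝ) (hs : 0 < s) (r : ℂ) (hr : 0 < r.re) :
    ∫ t in Ioi (0:ℝ), ((t ^ (s - 1) : ℝ) : ℂ) * Complex.exp (-(r * t)) =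
      Complex.Gamma s * r ^ (-(s:ℂ)) := by
  have hop : IsOpen {z : ℂ | 0 < z.re} := isOpen_lt continuous_const Complex.continuous_re
  have h1 : AnalyticOnNhd ℂ (fun r : ℂ => ∫ t in Ioi (0:ℝ), ((t ^ (s - 1) : ℝ) : ℂ) * Complex.exp (-(r * t)))
      {z : ℂ | 0 < z.re} :=
    DifferentiableOn.analyticOnNhd (fun z hz => (ml_laplace_diff s hs z hz).differentiableWithinAt) hop
  have h2 : AnalyticOnNhd ℂ (fun r : ℂ => Complex.Gamma s * r ^ (-(s:ℂ))) {z : ℂ | 0 < z.re} := by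
    refine DifferentiableOn.analyticOnNhd (fun z hz => ?_) hop
    have : z ∈ Complex.slitPlane := Or.inl hz
    exact ((differentiableAt_id.cpow_const this).const_mul _).differentiableWithinAt
  have hc : IsPreconnected {z : ℂ | 0 < z.re} := (convex_halfSpace_re_gt 0).isPreconnected
  have hreal : ∀ x : ℝ, 0 < x → ∫ t in Ioi (0:ℝ), ((t ^ (s - 1) : ℝ) : ℂ) * Complex.exp (-((x:ℂ) * t)) =
      Complex.Gamma s * (x:ℂ) ^ (-(s:ℂ)) := by
    intro x hx
    have := Complex.integral_cpow_mul_exp_neg_mul_Ioi (a := s) (r := x) (by simpa) hx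
    rw [one_div, Complex.inv_cpow _ _ (by rw [Complex.arg_ofReal_of_nonneg hx.le]; exact Real.pi_pos.ne),
      ← Complex.cpow_neg, mul_comm] at this
    rw [← this]
    refine setIntegral_congr_fun measurableSet_Ioi (fun t ht => ?_)
    rw [Complex.ofReal_cpow (le_of_lt ht)]
    simp
  refine h1.eqOn_of_preconnected_of_frequently_eq h2 hc (z₀ := 1) (by simp) ?_ hr
  have ht : Tendsto (fun n : ℕ => ((1 + 1 / ((n:ℝ) + 1) : ℝ) : ℂ)) atTop (𝓝[≠] 1) := by
    refine tendsto_nhdsWithin_iff.2 ⟨?_, Eventually.of_forall fun n => ?_⟩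
    · have : Tendsto (fun n : ℕ => (1 + 1 / ((n:ℝ) + 1) : ℝ)) atTop (𝓝 (1 + 0)) :=
        tendsto_const_nhds.add tendsto_one_div_add_atTop_nhds_zero_nat
      have h := (Complex.continuous_ofReal.tendsto _).comp this
      simpa [Function.comp_def] using h
    · simp only [mem_compl_iff, mem_singleton_iff]
      norm_cast
      have : (0:ℝ) < 1 / ((n:ℝ) + 1) := by positivity
      push_cast
      linarith
  refine ht.frequently (Eventually.of_forall fun n => hreal _ (by positivity)).frequently

noncomputable def mlp (x : ℝ) : ℂ := 1 + 2 * Real.pi * x * Complex.I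

lemma mlp_re (x : ℝ) : (mlp x).re = 1 := by simp [mlp]
lemma mlp_im (x : ℝ) : (mlp x).im = 2 * Real.pi * x := by simp [mlp]
lemma mlp_ne (x : ℝ) : mlp x ≠ 0 := fun h => by have := mlp_re x; simp [h] at this
lemma mlp_cont : Continuous mlp := by unfold mlp; fun_prop
lemma mlp_slit (x : ℝ) : mlp x ∈ Complex.slitPlane := Or.inl (by rw [mlp_re]; norm_num)
lemma mlp_cont_cpow (a : ℂ) : Continuous fun x => mlp x ^ a :=
  mlp_cont.cpow continuous_const mlp_slit
lemma mlp_norm (x : ℝ) : ‖mlp x‖ = (1 + ‖2 * Real.pi * x‖ ^ 2) ^ ((1:ℝ) / 2) := by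
  rw [← Real.sqrt_eq_rpow, Complex.norm_eq_sqrt_sq_add_sq, mlp_re, mlp_im, Real.norm_eq_abs, sq_abs]
  simp
lemma mlp_one_le (x : ℝ) : 1 ≤ ‖mlp x‖ := by
  have := Complex.re_le_norm (mlp x)
  rwa [mlp_re] at this
lemma mlp_norm_cpow (x a : ℝ) : ‖mlp x ^ (a:ℂ)‖ = ‖mlp x‖ ^ a := by
  rw [Complex.norm_cpow_of_ne_zero (mlp_ne x)]; simp

lemma mlp_integrable (s : ℝ) (hs : 1 < s) : Integrable fun x => ‖mlp x‖ ^ (-s) := by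
  have h := (integrable_rpow_neg_one_add_norm_sq (E := ℝ) (μ := volume) (r := s) (by simpa)).comp_mul_left'
    (R := 2 * Real.pi) (by positivity)
  refine h.congr (Eventually.of_forall fun x => ?_)
  simp only
  rw [mlp_norm, ← Real.rpow_mul (by positivity)]
  congr 1; ring

lemma mlp_exp_norm (x : ℝ) : ‖Complex.exp (mlp x)‖ = Real.exp 1 := by
  rw [Complex.norm_exp, mlp_re]

lemma ml_hankel (s : ℝ) (hs : 1 < s) :
    ∫ x, Complex.exp (mlp x) * mlp x ^ (-(s:ℂ)) = 1 / Complex.Gamma s := by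
  have hG : Complex.Gamma s ≠ 0 := by
    rw [Complex.Gamma_ofReal]; exact_mod_cast (Real.Gamma_pos_of_pos (by linarith)).ne'
  set f : ℝ → ℂ := (Ioi 0).indicator fun t : ℝ => ((t ^ (s - 1) : ℝ) : ℂ) * Complex.exp (-(1 * t)) with hf
  have hfi : Integrable f := by
    rw [hf, integrable_indicator_iff measurableSet_Ioi]
    exact ml_int_aux2 s (by linarith) 1 (by simp)
  have hF : 𝓕 f = fun x => Complex.Gamma s * mlp x ^ (-(s:ℂ)) := by
    ext x
    rw [Real.fourier_real_eq_integral_exp_smul, ← ml_laplace s (by linarith) (mlp x) (by simp [mlp_re]),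
      ← integral_indicator measurableSet_Ioi]
    congr 1
    ext t
    by_cases ht : t ∈ Ioi (0:ℝ)
    · simp only [hf, indicator_of_mem ht, smul_eq_mul]
      rw [mul_left_comm, ← Complex.exp_add]
      congr 2
      simp [mlp]; ring
    · simp [hf, indicator_of_notMem ht]
  have hFi : Integrable (𝓕 f) := by
    rw [hF]
    refine Integrable.const_mul ?_ _
    refine (mlp_integrable s hs).mono' (mlp_cont_cpow _).aestronglyMeasurable (Eventually.of_forall fun x => ?_)
    rw [← Complex.ofReal_neg, mlp_norm_cpow]
  have hca : ContinuousAt f 1 := by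
    have : f =ᶠ[𝓝 1] fun t : ℝ => ((t ^ (s - 1) : ℝ) : ℂ) * Complex.exp (-(1 * t)) := by
      filter_upwards [isOpen_Ioi.mem_nhds (show (1:ℝ) ∈ Ioi (0:ℝ) by simp)] with t ht
      simp [hf, indicator_of_mem ht]
    refine ContinuousAt.congr ?_ this.symm
    refine ContinuousAt.mul ?_ (by fun_prop)
    exact Complex.continuous_ofReal.continuousAt.comp
      (Real.continuousAt_rpow_const 1 (s-1) (Or.inl one_ne_zero))
  have hinv := hfi.fourierInv_fourier_eq hFi hca
  rw [Real.fourierInv_eq', hF] at hinv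
  have hf1 : f 1 = Complex.exp (-1) := by simp [hf]
  rw [hf1] at hinv
  rw [eq_div_iff hG, ← integral_mul_const]
  have : Complex.exp 1 * Complex.exp (-1) = 1 := by rw [← Complex.exp_add]; simp
  rw [← this, ← hinv, ← integral_const_mul]
  congr 1
  ext x
  have : Complex.exp (mlp x) = Complex.exp 1 * Complex.exp ((2 * Real.pi * x : ℝ) * Complex.I) := by
    rw [← Complex.exp_add]; simp [mlp]
  rw [this]
  simp
  ring

lemma ml_gamma_lower (R s : ℝ) (hR : 1 ≤ R) (hs : 1 ≤ s) :
    R ^ (s - 1) * Real.exp (-R) ≤ Real.Gamma s := by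
  rw [Real.Gamma_eq_integral (by linarith), ← integral_exp_neg_Ioi R, ← integral_const_mul]
  have hi := Real.GammaIntegral_convergent (s := s) (by linarith)
  have hsub : Ioi R ⊆ Ioi 0 := Ioi_subset_Ioi (by linarith)
  refine le_trans ?_ (setIntegral_mono_set hi ?_ hsub.eventuallyLE)
  · refine setIntegral_mono_on ((integrableOn_exp_neg_Ioi R).const_mul _) (hi.mono_set hsub)
      measurableSet_Ioi fun x hx => ?_
    have hx' : R < x := hx
    rw [mul_comm]
    gcongr
  · filter_upwards [ae_restrict_mem measurableSet_Ioi] with t ht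
    have ht' : 0 < t := ht
    simp only [Pi.zero_apply]
    positivity

lemma mlE_diff (α : ℝ) (hα : 0 < α) : Differentiable ℂ (mlE α 1) := by
  intro z₀
  set M : ℝ := ‖z₀‖ + 1 with hM
  have hM0 : 0 < M := by positivity
  set R : ℝ := (2 * M + 1) ^ (1 / α) with hR
  have hR1 : 1 ≤ R := Real.one_le_rpow (by linarith) (by positivity)
  have hRα : R ^ α = 2 * M + 1 := by
    rw [hR, ← Real.rpow_mul (by positivity), one_div_mul_cancel hα.ne', Real.rpow_one]
  have h := Complex.differentiableOn_tsum_of_summable_norm (U := Metric.ball (0:ℂ) M)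
    (F := fun (n : ℕ) z => z ^ n / Complex.Gamma ((α * n + 1 : ℝ) : ℂ))
    (u := fun n => Real.exp R * (M / (2 * M + 1)) ^ n) ?_ ?_ Metric.isOpen_ball ?_
  · exact h.differentiableAt (Metric.isOpen_ball.mem_nhds (by simp [hM]))
  · refine (summable_geometric_of_lt_one (by positivity) ?_).mul_left _
    rw [div_lt_one (by positivity)]; linarith
  · intro n
    fun_prop
  · intro n z hz
    have hz' : ‖z‖ ≤ M := by simpa using (mem_ball_zero_iff.1 hz).le
    have hg := ml_gamma_lower R (α * n + 1) hR1 (by have : 0 ≤ α * n := by positivity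
                                                    linarith)
    rw [add_sub_cancel_right, Real.rpow_mul (by linarith), hRα, Real.rpow_natCast] at hg
    have hgp : 0 < (2 * M + 1) ^ n * Real.exp (-R) := by positivity
    rw [Complex.Gamma_ofReal, norm_div, Complex.norm_real, norm_pow,
      Real.norm_of_nonneg (hgp.le.trans hg)]
    calc ‖z‖ ^ n / Real.Gamma (α * n + 1) ≤ M ^ n / ((2 * M + 1) ^ n * Real.exp (-R)) := by
          gcongr
      _ = _ := by
          rw [Real.exp_neg, div_pow]; field_simp

noncomputable def mlw (α : ℝ) (x : ℝ) : ℂ := mlp x ^ ((-α : ℝ) : ℂ)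

lemma mlw_norm_le (α : ℝ) (hα : 0 < α) (x : ℝ) : ‖mlw α x‖ ≤ 1 := by
  rw [mlw, mlp_norm_cpow]
  exact Real.rpow_le_one_of_one_le_of_nonpos (mlp_one_le x) (by linarith)

lemma mlw_ne (α : ℝ) (x : ℝ) : mlw α x ≠ 0 := by
  rw [mlw, Complex.cpow_ne_zero_iff]; exact Or.inl (mlp_ne x)

lemma mlw_cont (α : ℝ) : Continuous (mlw α) := mlp_cont_cpow _

lemma mlc_pos (α : ℝ) (hα0 : 0 < α) (hα1 : α < 1) : 0 < Real.cos (α * (Real.pi / 2)) := by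
  apply Real.cos_pos_of_mem_Ioo
  have := Real.pi_pos
  constructor <;> nlinarith

lemma mlw_re (α : ℝ) (hα0 : 0 < α) (hα1 : α < 1) (x : ℝ) :
    Real.cos (α * (Real.pi / 2)) * ‖mlw α x‖ ≤ (mlw α x).re := by
  have harg : |(mlp x).arg| ≤ Real.pi / 2 :=
    Complex.abs_arg_le_pi_div_two_iff.2 (by rw [mlp_re]; norm_num)
  have h1 : (mlw α x).re = ‖mlp x‖ ^ (-α) * Real.cos (α * (mlp x).arg) := by
    rw [mlw, Complex.cpow_ofReal_re]
    rw [mul_comm (mlp x).arg, neg_mul, Real.cos_neg]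
  rw [h1, mlw, mlp_norm_cpow, mul_comm]
  gcongr ?_ * ?_
  rw [← Real.cos_abs (α * (mlp x).arg), abs_mul, abs_of_pos hα0]
  apply Real.cos_le_cos_of_nonneg_of_le_pi
  · positivity
  · have := Real.pi_pos
    nlinarith
  · gcongr

lemma mlw_lower (α : ℝ) (hα0 : 0 < α) (hα1 : α < 1) (x : ℝ) (z : ℂ)
    (hz : z.re ≤ Real.cos (α * (Real.pi / 2)) / 2) :
    Real.cos (α * (Real.pi / 2)) / 2 ≤ ‖1 - z * mlw α x‖ := by
  set c := Real.cos (α * (Real.pi / 2)) with hc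
  have hc0 : 0 < c := mlc_pos α hα0 hα1
  set w := mlw α x with hw
  have hw0 : 0 < ‖w‖ := norm_pos_iff.2 (mlw_ne α x)
  have hw1 : ‖w‖ ≤ 1 := mlw_norm_le α hα0 x
  have hre : c * ‖w‖ ≤ w.re := mlw_re α hα0 hα1 x
  have h1 : 1 - z * w = w * (w⁻¹ - z) := by
    rw [mul_sub, mul_inv_cancel₀ (mlw_ne α x)]; ring
  have h2 : c / ‖w‖ - c / 2 ≤ ‖w⁻¹ - z‖ := by
    refine le_trans ?_ (Complex.re_le_norm _)
    rw [Complex.sub_re, Complex.inv_re, Complex.normSq_eq_norm_sq]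
    have : c / ‖w‖ ≤ w.re / ‖w‖ ^ 2 := by
      rw [div_le_div_iff₀ hw0 (by positivity)]
      nlinarith
    linarith
  rw [h1, norm_mul]
  calc c / 2 ≤ c - ‖w‖ * (c / 2) := by nlinarith
    _ = ‖w‖ * (c / ‖w‖ - c / 2) := by field_simp
    _ ≤ _ := by gcongr

noncomputable def mlh (α : ℝ) (q : ℂ) : ℂ := (1 - α) / (1 - q) + α / (1 - q) ^ 2

noncomputable def mlK (α : ℝ) (z : ℂ) (x : ℝ) : ℂ :=
  Complex.exp (mlp x) * mlp x ^ ((-2 : ℝ) : ℂ) * mlh α (z * mlw α x)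

lemma mlq_ne (α : ℝ) (hα0 : 0 < α) (hα1 : α < 1) (x : ℝ) (z : ℂ)
    (hz : z.re ≤ Real.cos (α * (Real.pi / 2)) / 2) : 1 - z * mlw α x ≠ 0 := by
  have := mlw_lower α hα0 hα1 x z hz
  have := mlc_pos α hα0 hα1
  exact norm_pos_iff.1 (by linarith)

lemma mlK_cont (α : ℝ) (hα0 : 0 < α) (hα1 : α < 1) (z : ℂ)
    (hz : z.re ≤ Real.cos (α * (Real.pi / 2)) / 2) : Continuous (mlK α z) := by
  have h := mlq_ne α hα0 hα1 (z := z) (hz := hz)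
  have h1 := mlp_cont
  have h2 := mlw_cont α
  have h3 := mlp_cont_cpow ((-2 : ℝ) : ℂ)
  unfold mlK mlh
  refine Continuous.mul (by fun_prop) (Continuous.add ?_ ?_)
  · exact Continuous.div (by fun_prop) (by fun_prop) h
  · exact Continuous.div (by fun_prop) (by fun_prop) fun x => pow_ne_zero 2 (h x)

lemma ml_pref_norm (x a : ℝ) :
    ‖Complex.exp (mlp x) * mlp x ^ (a : ℂ)‖ = Real.exp 1 * ‖mlp x‖ ^ a := by
  rw [norm_mul, mlp_exp_norm, mlp_norm_cpow]

lemma ml_pref_int (a : ℝ) (ha : 1 < a) :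
    Integrable fun x => Complex.exp (mlp x) * mlp x ^ ((-a : ℝ) : ℂ) := by
  refine ((mlp_integrable a ha).const_mul (Real.exp 1)).mono' ?_ (Eventually.of_forall fun x => ?_)
  · have h1 := mlp_cont
    have h3 := mlp_cont_cpow ((-a : ℝ) : ℂ)
    exact Continuous.aestronglyMeasurable (by fun_prop)
  · rw [ml_pref_norm]

/-- bounds for the inverse powers -/
lemma ml_inv_bound {k : ℝ} (hk : 0 < k) {u : ℂ} (hu : k ≤ ‖u‖) (a : ℂ) (n : ℕ) :
    ‖a / u ^ n‖ ≤ ‖a‖ / k ^ n := by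
  rw [norm_div, norm_pow]; gcongr

lemma mlK_bound (α : ℝ) (hα0 : 0 < α) (hα1 : α < 1) : ∃ B : ℝ, ∀ (z : ℂ),
    z.re ≤ Real.cos (α * (Real.pi / 2)) / 2 → ∀ x, ‖mlK α z x‖ ≤ B * ‖mlp x‖ ^ (-2 : ℝ) := by
  have hc := mlc_pos α hα0 hα1
  set k := Real.cos (α * (Real.pi / 2)) / 2 with hk
  have hk0 : 0 < k := by positivity
  refine ⟨Real.exp 1 * (‖(1 - α : ℂ)‖ / k ^ 1 + ‖(α : ℂ)‖ / k ^ 2), fun z hz x => ?_⟩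
  have hu := mlw_lower α hα0 hα1 x z hz
  rw [mlK, norm_mul, ml_pref_norm, mul_right_comm]
  gcongr
  unfold mlh
  refine (norm_add_le _ _).trans (add_le_add ?_ (ml_inv_bound hk0 hu _ _))
  simpa using ml_inv_bound hk0 hu (1 - α : ℂ) 1

lemma mlG_diff (α : ℝ) (hα0 : 0 < α) (hα1 : α < 1) (z : ℂ)
    (hz : z.re < Real.cos (α * (Real.pi / 2)) / 2) :
    DifferentiableAt ℂ (fun z => ∫ x, mlK α z x) z := by
  have hc := mlc_pos α hα0 hα1
  set k := Real.cos (α * (Real.pi / 2)) / 2 with hk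
  have hk0 : 0 < k := by positivity
  have hU : {z : ℂ | z.re < k} ∈ 𝓝 z :=
    (isOpen_lt Complex.continuous_re continuous_const).mem_nhds hz
  obtain ⟨B, hB⟩ := mlK_bound α hα0 hα1
  have key := hasDerivAt_integral_of_dominated_loc_of_deriv_le (𝕜 := ℂ)
    (μ := volume) (x₀ := z) (s := {z : ℂ | z.re < k})
    (F := fun z x => mlK α z x)
    (F' := fun z x => Complex.exp (mlp x) * mlp x ^ ((-2 : ℝ) : ℂ) *
      (((1 - α) / (1 - z * mlw α x) ^ 2 + (2 * α) / (1 - z * mlw α x) ^ 3) * mlw α x))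
    (bound := fun x => Real.exp 1 * ((‖(1 - α : ℂ)‖ / k ^ 2 + ‖(2 * α : ℂ)‖ / k ^ 3) * 1) *
      ‖mlp x‖ ^ (-2 : ℝ))
    hU ?_ ?_ ?_ ?_ ?_ ?_
  · exact key.2.differentiableAt
  · filter_upwards [hU] with y hy
    exact (mlK_cont α hα0 hα1 y (le_of_lt hy)).aestronglyMeasurable
  · exact ((mlp_integrable 2 (by norm_num)).const_mul B).mono'
      (mlK_cont α hα0 hα1 z hz.le).aestronglyMeasurable (Eventually.of_forall fun x => hB z hz.le x)
  · have h := mlq_ne α hα0 hα1 (z := z) (hz := hz.le)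
    have h1 := mlp_cont
    have h2 := mlw_cont α
    have h3 := mlp_cont_cpow ((-2 : ℝ) : ℂ)
    refine Continuous.aestronglyMeasurable ?_
    refine Continuous.mul (by fun_prop) (Continuous.mul (Continuous.add ?_ ?_) h2)
    · exact Continuous.div (by fun_prop) (by fun_prop) fun x => pow_ne_zero 2 (h x)
    · exact Continuous.div (by fun_prop) (by fun_prop) fun x => pow_ne_zero 3 (h x)
  · refine Eventually.of_forall fun x y hy => ?_
    have hu := mlw_lower α hα0 hα1 x y (le_of_lt hy)
    rw [norm_mul, ml_pref_norm, mul_right_comm, norm_mul _ (mlw α x)]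
    gcongr
    · exact (norm_add_le _ _).trans
        (add_le_add (ml_inv_bound hk0 hu _ _) (ml_inv_bound hk0 hu _ _))
    · exact mlw_norm_le α hα0 x
  · exact (mlp_integrable 2 (by norm_num)).const_mul _
  · refine Eventually.of_forall fun x y hy => ?_
    have h := mlq_ne α hα0 hα1 x y (le_of_lt hy)
    have hd : HasDerivAt (fun y : ℂ => 1 - y * mlw α x) (-(mlw α x)) y := by
      simpa using ((hasDerivAt_id' y).mul_const (mlw α x)).const_sub 1
    have h1 := ((hasDerivAt_const y (1 - α : ℂ)).fun_div hd h).fun_add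
      ((hasDerivAt_const y (α : ℂ)).fun_div (hd.fun_pow 2) (pow_ne_zero 2 h))
    have h2 := h1.const_mul (Complex.exp (mlp x) * mlp x ^ ((-2 : ℝ) : ℂ))
    unfold mlK mlh
    refine h2.congr_deriv ?_
    congr 1
    field_simp
    push_cast
    ring

lemma mlK_hasSum (α : ℝ) (hα0 : 0 < α) (z : ℂ) (hz : ‖z‖ < 1) (x : ℝ) :
    HasSum (fun n : ℕ => ((α * n + 1 : ℝ) : ℂ) * z ^ n *
      (Complex.exp (mlp x) * mlp x ^ ((-(α * n + 2) : ℝ) : ℂ))) (mlK α z x) := by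
  have hq : ‖z * mlw α x‖ < 1 := by
    rw [norm_mul]
    exact lt_of_le_of_lt (mul_le_of_le_one_right (norm_nonneg _) (mlw_norm_le α hα0 x)) hz
  have hne : 1 - z * mlw α x ≠ 0 := by
    intro h
    rw [sub_eq_zero] at h
    rw [← h] at hq
    simp at hq
  have h1 := (hasSum_coe_mul_geometric_of_norm_lt_one hq).mul_left (α : ℂ)
  have h2 := hasSum_geometric_of_norm_lt_one hq
  have h3 := (h1.add h2).mul_left (Complex.exp (mlp x) * mlp x ^ ((-2 : ℝ) : ℂ))
  convert! h3 using 1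
  · ext n
    have : mlp x ^ ((-(α * n + 2) : ℝ) : ℂ) = mlp x ^ ((-2 : ℝ) : ℂ) * mlw α x ^ n := by
      rw [mlw, ← Complex.cpow_nat_mul, ← Complex.cpow_add _ _ (mlp_ne x)]
      congr 1
      push_cast
      ring
    rw [this, mul_pow]
    push_cast
    ring
  · unfold mlK mlh
    congr 1
    field_simp
    ring

lemma mlE_eq_small (α : ℝ) (hα0 : 0 < α) (z : ℂ) (hz : ‖z‖ < 1) :
    mlE α 1 z = ∫ x, mlK α z x := by
  have hint : ∀ n : ℕ, Integrable fun x => ((α * n + 1 : ℝ) : ℂ) * z ^ n *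
      (Complex.exp (mlp x) * mlp x ^ ((-(α * n + 2) : ℝ) : ℂ)) := fun n =>
    (ml_pref_int (α * n + 2) (by have : 0 ≤ α * n := by positivity
                                 linarith)).const_mul _
  have h := hasSum_integral_of_summable_integral_norm hint ?_
  · have e : ∀ x, ∑' n : ℕ, ((α * n + 1 : ℝ) : ℂ) * z ^ n *
      (Complex.exp (mlp x) * mlp x ^ ((-(α * n + 2) : ℝ) : ℂ)) = mlK α z x :=
      fun x => (mlK_hasSum α hα0 z hz x).tsum_eq
    simp only [e] at h
    rw [← h.tsum_eq, mlE]
    congr 1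
    ext n
    have hn : 0 ≤ α * n := by positivity
    rw [integral_const_mul]
    have := ml_hankel (α * n + 2) (by linarith)
    rw [← Complex.ofReal_neg] at this
    rw [this]
    have hne : ((α * n + 1 : ℝ) : ℂ) ≠ 0 := by
      exact_mod_cast (by positivity : (α * n + 1 : ℝ) ≠ 0)
    have hg : ((α * n + 2 : ℝ) : ℂ) = ((α * n + 1 : ℝ) : ℂ) + 1 := by push_cast; ring
    rw [hg, Complex.Gamma_add_one _ hne]
    field_simp
  · have hs : Summable fun n : ℕ => (α * n + 1) * ‖z‖ ^ n * (Real.exp 1 * ∫ x, ‖mlp x‖ ^ (-2 : ℝ)) := by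
      refine Summable.mul_right _ ?_
      have h1 := (summable_pow_mul_geometric_of_norm_lt_one 1 (r := ‖z‖) (by simpa using hz)).mul_left α
      have h2 := summable_geometric_of_lt_one (norm_nonneg z) hz
      refine (h1.add h2).congr fun n => ?_
      ring
    refine Summable.of_nonneg_of_le (fun n => integral_nonneg fun x => norm_nonneg _) (fun n => ?_) hs
    have hn : 0 ≤ α * n := by positivity
    rw [← integral_const_mul, ← integral_const_mul]
    refine integral_mono (hint n).norm (((mlp_integrable 2 (by norm_num)).const_mul _).const_mul _) fun x => ?_
    simp only
    rw [norm_mul, ml_pref_norm, norm_mul, norm_pow, Complex.norm_real,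
      Real.norm_of_nonneg (by positivity : (0:ℝ) ≤ α * n + 1)]
    gcongr
    · exact mlp_one_le x
    · linarith

lemma mlE_eq (α : ℝ) (hα0 : 0 < α) (hα1 : α < 1) (z : ℂ) (hz : z.re ≤ 0) :
    mlE α 1 z = ∫ x, mlK α z x := by
  have hc := mlc_pos α hα0 hα1
  have hop : IsOpen {z : ℂ | z.re < Real.cos (α * (Real.pi / 2)) / 2} :=
    isOpen_lt Complex.continuous_re continuous_const
  have h1 : AnalyticOnNhd ℂ (mlE α 1) {z : ℂ | z.re < Real.cos (α * (Real.pi / 2)) / 2} :=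
    (mlE_diff α hα0).differentiableOn.analyticOnNhd hop
  have h2 : AnalyticOnNhd ℂ (fun z => ∫ x, mlK α z x)
      {z : ℂ | z.re < Real.cos (α * (Real.pi / 2)) / 2} :=
    DifferentiableOn.analyticOnNhd
      (fun z hz => (mlG_diff α hα0 hα1 z hz).differentiableWithinAt) hop
  refine h1.eqOn_of_preconnected_of_eventuallyEq h2 (convex_halfSpace_re_lt _).isPreconnected
    (z₀ := 0) (by simpa using hc) ?_ (show z.re < _ by linarith)
  filter_upwards [Metric.ball_mem_nhds (0:ℂ) one_pos] with y hy
  exact mlE_eq_small α hα0 y (by simpa using hy)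

lemma ml_limit (α : ℝ) (hα0 : 0 < α) (hα1 : α < 1) :
    Tendsto (fun t : ℝ => (-Complex.I * t) * mlE α 1 (-Complex.I * t)) atTop
      (𝓝 (-(1 - α) / Complex.Gamma ((2 - α : ℝ) : ℂ))) := by
  have hc := mlc_pos α hα0 hα1
  have hre : ∀ t : ℝ, (-Complex.I * t).re = 0 := fun t => by simp
  have hk : ∀ t : ℝ, (-Complex.I * t).re ≤ Real.cos (α * (Real.pi / 2)) / 2 := fun t => by
    rw [hre]; linarith
  have e1 : ∀ t : ℝ, (-Complex.I * t) * mlE α 1 (-Complex.I * t) =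
      ∫ x, (-Complex.I * t) * mlK α (-Complex.I * t) x := fun t => by
    rw [mlE_eq α hα0 hα1 _ (hre t).le, integral_const_mul]
  have e2 : -(1 - α) / Complex.Gamma ((2 - α : ℝ) : ℂ) =
      ∫ x, (Complex.exp (mlp x) * mlp x ^ ((-(2 - α) : ℝ) : ℂ)) * (-(1 - α)) := by
    have := ml_hankel (2 - α) (by linarith)
    rw [← Complex.ofReal_neg] at this
    rw [integral_mul_const, this]
    ring
  have e3 : ∀ (t x : ℝ), (-Complex.I * t) * mlK α (-Complex.I * t) x =
      (Complex.exp (mlp x) * mlp x ^ ((-(2 - α) : ℝ) : ℂ)) *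
      ((1 - α) * ((1 - (-Complex.I * t) * mlw α x)⁻¹ - 1) +
        α * ((1 - (-Complex.I * t) * mlw α x)⁻¹ - 1) * (1 - (-Complex.I * t) * mlw α x)⁻¹) := by
    intro t x
    have hne := mlq_ne α hα0 hα1 x _ (hk t)
    have hw : mlp x ^ ((-2 : ℝ) : ℂ) = mlp x ^ ((-(2 - α) : ℝ) : ℂ) * mlw α x := by
      rw [mlw, ← Complex.cpow_add _ _ (mlp_ne x)]
      congr 1
      push_cast
      ring
    rw [mlK, hw]
    unfold mlh
    generalize -Complex.I * (t:ℂ) = z at *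
    generalize mlw α x = w at *
    field_simp
    ring
  simp only [e1]
  rw [e2]
  set k := Real.cos (α * (Real.pi / 2)) / 2 with hkdef
  have hk0 : 0 < k := by positivity
  refine tendsto_integral_filter_of_dominated_convergence
    (fun x => Real.exp 1 * ‖mlp x‖ ^ (-(2 - α)) *
      (‖(1 - α : ℂ)‖ * (k⁻¹ + 1) + ‖(α : ℂ)‖ * (k⁻¹ + 1) * k⁻¹)) ?_ ?_ ?_ ?_
  · exact Eventually.of_forall fun t =>
      (continuous_const.mul (mlK_cont α hα0 hα1 _ (hk t))).aestronglyMeasurable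
  · refine Eventually.of_forall fun t => Eventually.of_forall fun x => ?_
    rw [e3, norm_mul, ml_pref_norm]
    have hu : ‖(1 - (-Complex.I * t) * mlw α x)⁻¹‖ ≤ k⁻¹ := by
      rw [norm_inv]
      exact inv_anti₀ hk0 (mlw_lower α hα0 hα1 x _ (hk t))
    generalize (1 - (-Complex.I * t) * mlw α x)⁻¹ = u at *
    have hu1 : ‖u - 1‖ ≤ k⁻¹ + 1 := (norm_sub_le _ _).trans (by simpa using hu)
    gcongr
    refine (norm_add_le _ _).trans ?_
    rw [norm_mul, norm_mul, norm_mul]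
    gcongr
  · exact ((mlp_integrable (2 - α) (by linarith)).const_mul _).mul_const _
  · refine Eventually.of_forall fun x => ?_
    simp only [e3]
    have hu : Tendsto (fun t : ℝ => (1 - (-Complex.I * t) * mlw α x)⁻¹) atTop (𝓝 0) := by
      refine tendsto_inv₀_cobounded.comp ?_
      rw [← tendsto_norm_atTop_iff_cobounded]
      have hw : 0 < ‖mlw α x‖ := norm_pos_iff.2 (mlw_ne α x)
      refine tendsto_atTop_mono' _ ?_ (tendsto_atTop_add_const_right _ (-1)
        (tendsto_id.atTop_mul_const hw))
      filter_upwards [eventually_ge_atTop 0] with t ht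
      have := norm_sub_norm_le ((-Complex.I * t) * mlw α x) 1
      rw [norm_sub_rev, norm_mul, norm_mul, Complex.norm_real, Real.norm_of_nonneg ht] at this
      simp at this
      simp
      linarith
    have := ((((hu.sub_const 1).const_mul (1 - α : ℂ)).add
      (((hu.sub_const 1).const_mul (α : ℂ)).mul hu))).const_mul
        (Complex.exp (mlp x) * mlp x ^ ((-(2 - α) : ℝ) : ℂ))
    convert! this using 2
    ring

theorem mittagLeffler_inverse_bound (α : ℝ) (hα0 : 0 < α) (hα1 : α < 1)
    (T : ℝ) (hT : 0 < T) (lam1 : ℝ) (hlam1 : 0 < lam1)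
    (hnz : ∀ lam : ℝ, lam1 ≤ lam → mlE α 1 (-Complex.I * lam * (T ^ α : ℝ)) ≠ 0) :
    ∃ C : ℝ, 0 < C ∧ ∀ lam : ℝ, lam1 ≤ lam →
      ‖mlE α 1 (-Complex.I * lam * (T ^ α : ℝ))‖⁻¹ ≤ C * lam := by
  have hTα : 0 < T ^ α := Real.rpow_pos_of_pos hT _
  set g : ℝ → ℝ := fun lam => lam * ‖mlE α 1 (-Complex.I * lam * (T ^ α : ℝ))‖ with hg
  have hgc : Continuous g := by
    have := (mlE_diff α hα0).continuous
    rw [hg]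
    fun_prop
  have hL : (0:ℝ) < ‖-(1 - α : ℂ) / Complex.Gamma ((2 - α : ℝ) : ℂ)‖ := by
    rw [norm_pos_iff, Complex.Gamma_ofReal]
    refine div_ne_zero (neg_ne_zero.2 ?_) ?_
    · exact_mod_cast (by linarith : (0:ℝ) < 1 - α).ne'
    · exact_mod_cast (Real.Gamma_pos_of_pos (by linarith)).ne'
  set L := ‖-(1 - α : ℂ) / Complex.Gamma ((2 - α : ℝ) : ℂ)‖ with hLdef
  have hlim : Tendsto (fun lam : ℝ => g lam * T ^ α) atTop (𝓝 L) := by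
    have h1 := ((ml_limit α hα0 hα1).norm).comp (tendsto_id.atTop_mul_const hTα)
    refine h1.congr' ?_
    filter_upwards [eventually_ge_atTop 0] with lam hlam
    simp only [Function.comp_apply, id, hg, norm_mul, norm_neg, Complex.norm_I, one_mul,
      Complex.norm_real, Complex.ofReal_mul, Real.norm_of_nonneg hlam, Real.norm_of_nonneg hTα.le,
      mul_assoc]
    ring
  obtain ⟨R, hR⟩ := eventually_atTop.1 (hlim.eventually (lt_mem_nhds (half_lt_self hL)))
  obtain ⟨x0, hx0, hmin⟩ := isCompact_Icc.exists_isMinOn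
    (nonempty_Icc.2 (le_max_left lam1 R)) hgc.continuousOn
  have hgpos : ∀ lam, lam1 ≤ lam → 0 < g lam := fun lam h =>
    mul_pos (by linarith) (norm_pos_iff.2 (hnz lam h))
  set m := min (g x0) (L / 2 / T ^ α) with hm
  have hm0 : 0 < m := lt_min (hgpos x0 hx0.1) (by positivity)
  refine ⟨m⁻¹, inv_pos.2 hm0, fun lam hlam => ?_⟩
  have hlow : m ≤ g lam := by
    rcases le_total lam (max lam1 R) with h | h
    · exact (min_le_left _ _).trans (hmin ⟨hlam, h⟩)
    · refine (min_le_right _ _).trans ?_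
      rw [div_le_iff₀ hTα]
      exact (hR lam ((le_max_right _ _).trans h)).le
  have hE := norm_pos_iff.2 (hnz lam hlam)
  rw [inv_le_iff_one_le_mul₀ hE, mul_assoc, ← div_eq_inv_mul, one_le_div hm0]
  exact hlow
end
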